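/- Let n ≥ 1, p ≥ 1, let 𝒮 = (S_0,…,S_{2n}) in 𝕊_p(ℝ) admit a representing measure, and fix t ∈ ℝ. With T_i the shifted moments, set ℳ₁ := (T_{i+j−2})_{i,j=1}^{n+1}, N₂ := (T_{i+j−2})_{i,j=1}^{n} and N₃ := (T_{i+j})_{i,j=1}^{n}, and let A be the index set defined from the columns of ℳ₁. Then the following are equivalent: (1) there exists a minimal representing measure μ for 𝒮 with mult_μ t = 0; (2) A = ∅; (3) Ker N₂ = Ker N₃. -/

import Mathlib

open Finset Matrix

/-- The block Hankel moment matrix `M(n) = (S_{i+j-2})_{i,j=1}^{n+1}`. -/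
def momentMatrix (n p : ℕ) (S : ℕ → Matrix (Fin p) (Fin p) ℝ) :
    Matrix (Fin (n + 1) × Fin p) (Fin (n + 1) × Fin p) ℝ :=
  fun ia jb => S (ia.1.1 + jb.1.1) ia.2 jb.2

/-- A (finitely atomic) representing measure for `S_0, …, S_{2n}`. -/
def IsRepMeasure (n p : ℕ) (S : ℕ → Matrix (Fin p) (Fin p) ℝ) (ℓ : ℕ)
    (x : Fin ℓ → ℝ) (A : Fin ℓ → Matrix (Fin p) (Fin p) ℝ) : Prop :=
  Function.Injective x ∧ (∀ j, (A j).PosSemidef) ∧ (∀ j, A j ≠ 0) ∧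
    ∀ i, i ≤ 2 * n → S i = ∑ j, x j ^ i • A j

/-- Minimality of a representing measure. -/
def IsMinimal (n p : ℕ) (S : ℕ → Matrix (Fin p) (Fin p) ℝ) {ℓ : ℕ}
    (A : Fin ℓ → Matrix (Fin p) (Fin p) ℝ) : Prop :=
  (∑ j, (A j).rank) = (momentMatrix n p S).rank

/-- `mult_μ t = m`. -/
def MultEq {p ℓ : ℕ} (x : Fin ℓ → ℝ) (A : Fin ℓ → Matrix (Fin p) (Fin p) ℝ)
    (t : ℝ) (m : ℕ) : Prop :=
  (∃ j, x j = t ∧ (A j).rank = m) ∨ ((∀ j, x j ≠ t) ∧ m = 0)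

/-- The shifted moments `T_i = ∑_{ℓ=0}^{i} C(i,ℓ)(-1)^ℓ t^ℓ S_{i-ℓ}`. -/
def shiftT (p : ℕ) (t : ℝ) (S : ℕ → Matrix (Fin p) (Fin p) ℝ) (i : ℕ) :
    Matrix (Fin p) (Fin p) ℝ :=
  ∑ l ∈ Finset.range (i + 1), ((i.choose l : ℝ) * (-1) ^ l * t ^ l) • S (i - l)

/-- The `j`-th column (1-based) of `ℳ₁ = (T_{i+j-2})_{i,j=1}^{n+1}`. -/
def colM1 (n p : ℕ) (hp : 0 < p) (T : ℕ → Matrix (Fin p) (Fin p) ℝ) (j : ℕ) :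
    Fin (n + 1) × Fin p → ℝ :=
  fun ia => T (ia.1.1 + (j - 1) / p) ia.2 ⟨(j - 1) % p, Nat.mod_lt _ hp⟩

/-- The index set `A` of Theorem 1.1. -/
def setA (n p : ℕ) (hp : 0 < p) (T : ℕ → Matrix (Fin p) (Fin p) ℝ) : Set ℕ :=
  {i | i ∈ Set.Icc 1 p ∧ ∃ k ∈ Set.Icc 1 n,
    colM1 n p hp T (k * p + i) ∈
      Submodule.span ℝ (colM1 n p hp T '' Set.Icc (p + 1) (k * p + i - 1)) ∧
    colM1 n p hp T ((k - 1) * p + i) ∉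
      Submodule.span ℝ (colM1 n p hp T '' Set.Icc 1 ((k - 1) * p + i - 1))}

/-- `N₂ = (T_{i+j-2})_{i,j=1}^{n}` (0-based block entry `T_{i+j}`). -/
def matN2 (n p : ℕ) (T : ℕ → Matrix (Fin p) (Fin p) ℝ) :
    Matrix (Fin n × Fin p) (Fin n × Fin p) ℝ :=
  fun ia jb => T (ia.1.1 + jb.1.1) ia.2 jb.2

/-- `N₃ = (T_{i+j})_{i,j=1}^{n}` (0-based block entry `T_{i+j+2}`). -/
def matN3 (n p : ℕ) (T : ℕ → Matrix (Fin p) (Fin p) ℝ) :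
    Matrix (Fin n × Fin p) (Fin n × Fin p) ℝ :=
  fun ia jb => T (ia.1.1 + jb.1.1 + 2) ia.2 jb.2

/-- A symmetric operator without eigenvector for `t` in a subspace `K` can be modified off `K`
to a symmetric operator that does not have the eigenvalue `t` at all. -/
theorem exists_isSymmetric_eqOn_of_injOn {H : Type*} [NormedAddCommGroup H] [InnerProductSpace ℝ H]
    [FiniteDimensional ℝ H] (K : Submodule ℝ H) (C : H →ₗ[ℝ] H) (hC : C.IsSymmetric) (t : ℝ)
    (hinj : ∀ v ∈ K, C v = t • v → v = 0) :
    ∃ B : H →ₗ[ℝ] H, B.IsSymmetric ∧ (∀ v ∈ K, B v = C v) ∧ ∀ v, B v = t • v → v = 0 := by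
  set P : H →ₗ[ℝ] H := Kᗮ.starProjection.toLinearMap with hPdef
  have hPs : P.IsSymmetric := Kᗮ.starProjection_isSymmetric
  have hP0 : ∀ v ∈ K, P v = 0 := fun v hv ↦ by
    simpa [hPdef] using Submodule.starProjection_orthogonal_apply_eq_zero hv
  have hPK : ∀ v, P v = 0 → v ∈ K := fun v hv ↦ by
    have h := Submodule.starProjection_orthogonal_val (K := K) v
    rw [show Kᗮ.starProjection v = 0 from hv] at h
    rw [← Submodule.starProjection_eq_self_iff]
    exact (sub_eq_zero.mp h.symm).symm
  have hPP : ∀ v w, inner ℝ (P v) (P w) = inner ℝ (P v) w := fun v w ↦ by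
    rw [hPs, hPs]
    congr 1
    exact Submodule.starProjection_eq_self_iff.mpr (Submodule.starProjection_apply_mem _ _)
  obtain ⟨r, hr⟩ : ∃ r : ℝ, ∀ v, C v + r • P v = t • v → v = 0 := by
    by_contra! hcon
    choose v hv hv0 using hcon
    have hli : LinearIndependent ℝ (fun r ↦ P (v r)) := by
      refine linearIndependent_of_ne_zero_of_inner_eq_zero (fun r h0 ↦ ?_) (fun r s hrs ↦ ?_)
      · refine hv0 r (hinj _ (hPK _ h0) ?_)
        simpa [h0] using hv r
      · have h1 : inner ℝ (C (v r) + r • P (v r)) (v s) = t * inner ℝ (v r) (v s) := by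
          rw [hv r, inner_smul_left]; rfl
        have h2 : inner ℝ (v r) (C (v s) + s • P (v s)) = t * inner ℝ (v r) (v s) := by
          rw [hv s, inner_smul_right]
        rw [inner_add_left, inner_smul_left] at h1
        rw [inner_add_right, inner_smul_right, ← hC, ← hPs] at h2
        simp only [hPP]
        have h3 : (r - s) * inner ℝ (P (v r)) (v s) = 0 := by
          simp only [conj_trivial] at h1
          linarith
        exact (mul_eq_zero.mp h3).resolve_left (sub_ne_zero.mpr hrs)
    have := hli.finite
    exact not_finite ℝ
  refine ⟨C + r • P, fun v w ↦ ?_, fun v hv ↦ by simp [hP0 v hv],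
    fun v hv ↦ hr v (by simpa using hv)⟩
  simp only [LinearMap.add_apply, LinearMap.smul_apply, inner_add_left, inner_add_right,
    inner_smul_left, inner_smul_right, hC v w, hPs v w, conj_trivial]

/-- The span of the vectors `D ^ i (e a)` with `i < k`. -/
def krylov {E ι : Type*} [AddCommGroup E] [Module ℝ E] (D : E →ₗ[ℝ] E) (e : ι → E) (k : ℕ) :
    Submodule ℝ E :=
  Submodule.span ℝ {u | ∃ i < k, ∃ a, u = (D ^ i) (e a)}

theorem pow_apply_mem_krylov {E ι : Type*} [AddCommGroup E] [Module ℝ E] (D : E →ₗ[ℝ] E)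
    (e : ι → E) {i k : ℕ} (hi : i < k) (a : ι) : (D ^ i) (e a) ∈ krylov D e k :=
  Submodule.subset_span ⟨i, hi, a, rfl⟩

theorem map_mem_krylov_succ {E ι : Type*} [AddCommGroup E] [Module ℝ E] (D : E →ₗ[ℝ] E)
    (e : ι → E) {k : ℕ} {u : E} (hu : u ∈ krylov D e k) : D u ∈ krylov D e (k + 1) := by
  have h : krylov D e k ≤ (krylov D e (k + 1)).comap D := by
    refine Submodule.span_le.mpr ?_
    rintro _ ⟨i, hi, a, rfl⟩
    have := pow_apply_mem_krylov D e (Nat.succ_lt_succ hi) a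
    rwa [pow_succ', Module.End.mul_apply] at this
  exact h hu

theorem krylov_le_krylov_sub {E ι : Type*} [AddCommGroup E] [Module ℝ E] (D : E →ₗ[ℝ] E)
    (e : ι → E) (t : ℝ) (k : ℕ) : krylov D e k ≤ krylov (D - t • 1) e k := by
  refine Submodule.span_le.mpr ?_
  rintro _ ⟨i, hi, a, rfl⟩
  induction i with
  | zero => exact pow_apply_mem_krylov (D - t • 1) e hi a
  | succ i _ =>
    have hcomm : Commute (D - t • 1) (t • (1 : Module.End ℝ E)) :=
      (Commute.one_right _).smul_right t
    have hsplit : D = (D - t • 1) + t • 1 := by abel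
    rw [hsplit, hcomm.add_pow, ← hsplit, LinearMap.sum_apply]
    refine Submodule.sum_mem _ fun m hm ↦ ?_
    rw [smul_pow, one_pow, mul_smul_comm, mul_one, smul_mul_assoc, LinearMap.smul_apply,
      ← nsmul_eq_mul', LinearMap.smul_apply]
    refine Submodule.smul_mem _ _ (Submodule.smul_of_tower_mem _ _ ?_)
    exact pow_apply_mem_krylov _ e (by have := Finset.mem_range.mp hm; omega) a

/-- Truncated moments of a symmetric operator are represented by as many weighted points, all
different from `t`, as the dimension of the Krylov space. -/
theorem exists_quadrature {E ι : Type*} [NormedAddCommGroup E] [InnerProductSpace ℝ E]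
    [FiniteDimensional ℝ E] (D : E →ₗ[ℝ] E) (hD : D.IsSymmetric) (e : ι → E) (n : ℕ) (t : ℝ)
    (hinj : ∀ u ∈ krylov D e n, D u = t • u → u = 0) :
    ∃ (y : Fin (Module.finrank ℝ (krylov D e (n + 1))) → ℝ)
      (w : Fin (Module.finrank ℝ (krylov D e (n + 1))) → ι → ℝ),
      (∀ m, y m ≠ t) ∧
      ∀ i ≤ 2 * n, ∀ a b, inner ℝ ((D ^ i) (e a)) (e b) = ∑ m, y m ^ i * (w m a * w m b) := by
  set H := krylov D e (n + 1) with hH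
  let K : Submodule ℝ H := (krylov D e n).comap H.subtype
  let C : H →ₗ[ℝ] H := (H.orthogonalProjectionOnto : E →ₗ[ℝ] H) ∘ₗ D ∘ₗ H.subtype
  have hCs : C.IsSymmetric := fun v w ↦ by
    change inner ℝ (H.orthogonalProjectionOnto (D v)) w =
      inner ℝ v (H.orthogonalProjectionOnto (D w))
    rw [Submodule.inner_orthogonalProjectionOnto_eq_of_mem_right,
      Submodule.inner_orthogonalProjectionOnto_eq_of_mem_left, hD]
  have hCK : ∀ v ∈ K, (C v : E) = D v := fun v hv ↦ by
    change ((H.orthogonalProjectionOnto (D v) : H) : E) = D v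
    exact Submodule.starProjection_eq_self_iff.mpr (map_mem_krylov_succ D e hv)
  obtain ⟨B, hBs, hBC, hBt⟩ := exists_isSymmetric_eqOn_of_injOn K C hCs t fun v hv h ↦ by
    have := hinj v hv (by rw [← hCK v hv, h]; rfl)
    exact_mod_cast this
  let f : ι → H := fun a ↦ ⟨e a, pow_apply_mem_krylov D e (Nat.succ_pos n) a⟩
  have hpow : ∀ i ≤ n, ∀ a, (((B ^ i) (f a) : H) : E) = (D ^ i) (e a) := by
    intro i hi a
    induction i with
    | zero => rfl
    | succ i ih =>
      have h := ih (by omega)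
      have hK : (B ^ i) (f a) ∈ K := by
        change (((B ^ i) (f a) : H) : E) ∈ krylov D e n
        rw [h]
        exact pow_apply_mem_krylov D e (by omega) a
      rw [pow_succ', Module.End.mul_apply, hBC _ hK, hCK _ hK, h, pow_succ', Module.End.mul_apply]
  have hBpow : ∀ (i : ℕ) (v w : H), inner ℝ ((B ^ i) v) w = inner ℝ v ((B ^ i) w) :=
    fun i v w ↦ hBs.pow i v w
  have hmom : ∀ i ≤ 2 * n, ∀ a b,
      inner ℝ ((D ^ i) (e a)) (e b) = inner ℝ ((B ^ i) (f a)) (f b) := by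
    intro i hi a b
    obtain ⟨k, l, hk, hl, rfl⟩ : ∃ k l, k ≤ n ∧ l ≤ n ∧ i = k + l :=
      ⟨min i n, i - n, by omega, by omega, by omega⟩
    rw [pow_add, pow_add, Module.End.mul_apply, Module.End.mul_apply, hD.pow k, hBpow k,
      Submodule.coe_inner, hpow l hl, hpow k hk]
  let b := hBs.eigenvectorBasis rfl
  let y := hBs.eigenvalues rfl
  have hb : ∀ m, B (b m) = y m • b m := fun m ↦ hBs.apply_eigenvectorBasis rfl m
  have hbpow : ∀ i m, (B ^ i) (b m) = y m ^ i • b m := by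
    intro i m
    induction i with
    | zero => simp
    | succ i ih => rw [pow_succ, Module.End.mul_apply, hb, map_smul, ih, smul_smul, pow_succ']
  refine ⟨y, fun m a ↦ inner ℝ (f a) (b m), fun m hm ↦ ?_, fun i hi a c ↦ ?_⟩
  · exact b.orthonormal.ne_zero m (hBt _ (hm ▸ hb m))
  · rw [hmom i hi, ← b.sum_inner_mul_inner]
    refine Finset.sum_congr rfl fun m _ ↦ ?_
    rw [hBpow, hbpow, inner_smul_right, real_inner_comm (f c)]
    ring

theorem Matrix.rank_add_le_rank_add_rank {m n : Type*} [Fintype n] [Finite m] (A B : Matrix m n ℝ) :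
    (A + B).rank ≤ A.rank + B.rank := by
  have h : (A + B).mulVecLin.range ≤ A.mulVecLin.range ⊔ B.mulVecLin.range := by
    rintro _ ⟨v, rfl⟩
    rw [Matrix.mulVecLin_add]
    exact Submodule.add_mem_sup ⟨v, rfl⟩ ⟨v, rfl⟩
  exact (Submodule.finrank_mono h).trans (Submodule.finrank_add_le_finrank_add_finrank _ _)

theorem Matrix.rank_sum_le_sum_rank {ι m n : Type*} [Fintype n] [Finite m] (s : Finset ι)
    (A : ι → Matrix m n ℝ) : (∑ i ∈ s, A i).rank ≤ ∑ i ∈ s, (A i).rank := by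
  classical
  induction s using Finset.induction_on with
  | empty => simp
  | insert i s hi ih =>
    rw [Finset.sum_insert hi, Finset.sum_insert hi]
    exact (Matrix.rank_add_le_rank_add_rank _ _).trans (by omega)

theorem IsRepMeasure.rank_momentMatrix_le {n p : ℕ} {S : ℕ → Matrix (Fin p) (Fin p) ℝ} {ℓ : ℕ}
    {x : Fin ℓ → ℝ} {A : Fin ℓ → Matrix (Fin p) (Fin p) ℝ} (h : IsRepMeasure n p S ℓ x A) :
    (momentMatrix n p S).rank ≤ ∑ j, (A j).rank := by
  let C : Fin ℓ → Matrix (Fin (n + 1) × Fin p) (Fin p) ℝ :=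
    fun j ↦ Matrix.of fun ia b ↦ x j ^ ia.1.1 * (1 : Matrix (Fin p) (Fin p) ℝ) ia.2 b
  have hM : momentMatrix n p S = ∑ j, C j * A j * (C j)ᵀ := by
    ext ⟨i, a⟩ ⟨k, b⟩
    rw [momentMatrix, h.2.2.2 _ (by have := i.2; have := k.2; dsimp only; omega)]
    simp only [Matrix.sum_apply, Matrix.smul_apply, smul_eq_mul]
    refine Finset.sum_congr rfl fun j _ ↦ ?_
    simp [C, Matrix.mul_apply, Matrix.one_apply, pow_add]
    ring
  rw [hM]
  exact (Matrix.rank_sum_le_sum_rank _ _).trans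
    (Finset.sum_le_sum fun j _ ↦ (Matrix.rank_mul_le_left _ _).trans (Matrix.rank_mul_le_right _ _))

theorem Matrix.eq_zero_of_rank_eq_zero {m n : Type*} [Fintype n] [Finite m] {A : Matrix m n ℝ}
    (hA : A.rank = 0) : A = 0 := by
  have h0 : A.mulVecLin.range = ⊥ := Submodule.finrank_eq_zero.mp hA
  classical
  refine Matrix.ext_of_mulVec_single fun i ↦ ?_
  have h : A.mulVecLin (Pi.single i 1) ∈ A.mulVecLin.range := ⟨_, rfl⟩
  rw [h0, Submodule.mem_bot, Matrix.mulVecLin_apply] at h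
  rw [h, Matrix.zero_mulVec]

theorem exists_isRepMeasure_of_weighted_points {n p N : ℕ} {S : ℕ → Matrix (Fin p) (Fin p) ℝ}
    {t : ℝ} (y : Fin N → ℝ) (w : Fin N → Fin p → ℝ) (hy : ∀ m, y m ≠ t)
    (hS : ∀ i ≤ 2 * n, ∀ a b, S i a b = ∑ m, y m ^ i * (w m a * w m b)) :
    ∃ (ℓ : ℕ) (x : Fin ℓ → ℝ) (A : Fin ℓ → Matrix (Fin p) (Fin p) ℝ),
      IsRepMeasure n p S ℓ x A ∧ ∑ j, (A j).rank ≤ N ∧ ∀ j, x j ≠ t := by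
  let F : ℝ → Matrix (Fin p) (Fin p) ℝ :=
    fun c ↦ ∑ m with y m = c, Matrix.vecMulVec (w m) (w m)
  let s : Finset ℝ := (Finset.univ.image y).filter fun c ↦ F c ≠ 0
  let x : Fin s.card → ℝ := fun j ↦ s.equivFin.symm j
  have hsum : ∀ {M : Type} [AddCommMonoid M] (g : ℝ → M), ∑ j, g (x j) = ∑ c ∈ s, g c := by
    intro M _ g
    rw [← Finset.sum_coe_sort s]
    exact Equiv.sum_comp s.equivFin.symm fun c : s ↦ g c
  have hxs : ∀ j, x j ∈ s := fun j ↦ (s.equivFin.symm j).2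
  refine ⟨s.card, x, fun j ↦ F (x j), ⟨fun i j hij ↦ ?_, fun j ↦ ?_, fun j ↦ ?_, fun i hi ↦ ?_⟩,
    ?_, fun j ↦ ?_⟩
  · exact s.equivFin.symm.injective (Subtype.ext hij)
  · exact Matrix.posSemidef_sum _ fun m _ ↦ by
      simpa using Matrix.posSemidef_vecMulVec_self_star (w m)
  · exact (Finset.mem_filter.mp (hxs j)).2
  · rw [hsum fun c ↦ c ^ i • F c, Finset.sum_filter_of_ne]
    · ext a b
      rw [hS i hi, ← Finset.sum_fiberwise_of_maps_to (t := Finset.univ.image y)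
        (fun m _ ↦ Finset.mem_image_of_mem y (Finset.mem_univ m)), Matrix.sum_apply]
      refine Finset.sum_congr rfl fun c _ ↦ ?_
      simp only [F, Matrix.smul_apply, Matrix.sum_apply, smul_eq_mul, Finset.mul_sum,
        Matrix.vecMulVec_apply]
      refine Finset.sum_congr rfl fun m hm ↦ ?_
      rw [(Finset.mem_filter.mp hm).2]
    · intro c _ hc h0
      exact hc (by rw [h0, smul_zero])
  · rw [hsum fun c ↦ (F c).rank]
    calc ∑ c ∈ s, (F c).rank ≤ ∑ c ∈ Finset.univ.image y, (F c).rank :=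
          Finset.sum_le_sum_of_subset (Finset.filter_subset _ _)
      _ ≤ ∑ c ∈ Finset.univ.image y, (Finset.univ.filter fun m ↦ y m = c).card := by
          refine Finset.sum_le_sum fun c _ ↦ (Matrix.rank_sum_le_sum_rank _ _).trans ?_
          exact (Finset.sum_le_sum fun m _ ↦ Matrix.rank_vecMulVec_le _ _).trans (by simp)
      _ = N := by
          rw [← Finset.card_eq_sum_card_fiberwise fun m _ ↦ by simp]
          simp
  · obtain ⟨m, -, hm⟩ := Finset.mem_image.mp (Finset.mem_filter.mp (hxs j)).1
    exact hm ▸ hy m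

theorem krylov_eq_span_range {E ι : Type*} [AddCommGroup E] [Module ℝ E] (D : E →ₗ[ℝ] E)
    (e : ι → E) (k : ℕ) :
    krylov D e k = Submodule.span ℝ (Set.range fun ia : Fin k × ι ↦ (D ^ ia.1.1) (e ia.2)) := by
  refine congrArg _ (Set.ext fun u ↦ ⟨?_, ?_⟩)
  · rintro ⟨i, hi, a, rfl⟩
    exact ⟨(⟨i, hi⟩, a), rfl⟩
  · rintro ⟨ia, rfl⟩
    exact ⟨ia.1, ia.1.2, ia.2, rfl⟩

theorem mem_krylov_iff {E ι : Type*} [Fintype ι] [AddCommGroup E] [Module ℝ E] (D : E →ₗ[ℝ] E)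
    (e : ι → E) {k : ℕ} {u : E} :
    u ∈ krylov D e k ↔ ∃ v : Fin k × ι → ℝ, ∑ ia, v ia • (D ^ ia.1.1) (e ia.2) = u := by
  rw [krylov_eq_span_range, Submodule.mem_span_range_iff_exists_fun]

section Gram

variable {E κ : Type*} [Fintype κ] [NormedAddCommGroup E] [InnerProductSpace ℝ E]

theorem mulVec_eq_zero_iff_of_gram {M : Matrix κ κ ℝ} {g : κ → E}
    (hM : ∀ i j, M i j = inner ℝ (g i) (g j)) (v : κ → ℝ) :
    M *ᵥ v = 0 ↔ ∑ i, v i • g i = 0 := by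
  have hrow : ∀ i, (M *ᵥ v) i = inner ℝ (g i) (∑ j, v j • g j) := fun i ↦ by
    simp only [Matrix.mulVec, dotProduct, inner_sum, inner_smul_right, hM, mul_comm]
  refine ⟨fun h ↦ ?_, fun h ↦ funext fun i ↦ by rw [hrow, h, inner_zero_right]; rfl⟩
  rw [← inner_self_eq_zero (𝕜 := ℝ), sum_inner]
  refine Finset.sum_eq_zero fun i _ ↦ ?_
  rw [inner_smul_left, ← hrow, h, Pi.zero_apply, mul_zero]

theorem rank_eq_finrank_span_of_gram {M : Matrix κ κ ℝ} {g : κ → E}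
    (hM : ∀ i j, M i j = inner ℝ (g i) (g j)) :
    M.rank = Module.finrank ℝ (Submodule.span ℝ (Set.range g)) := by
  have hker : M.mulVecLin.ker = (Fintype.linearCombination ℝ g).ker := by
    ext v
    simpa [Fintype.linearCombination_apply] using mulVec_eq_zero_iff_of_gram hM v
  have h1 := M.mulVecLin.finrank_range_add_finrank_ker
  have h2 := (Fintype.linearCombination ℝ g).finrank_range_add_finrank_ker
  rw [Fintype.range_linearCombination] at h2
  rw [hker] at h1
  rw [Matrix.rank]
  omega

end Gram

/-- The sequence `T` restricted to `0, …, 2 * n` consists of the moments of the operator `D`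
compressed to the vectors `e a`. -/
def IsOperatorMoments {E : Type*} [NormedAddCommGroup E] [InnerProductSpace ℝ E] (n p : ℕ)
    (T : ℕ → Matrix (Fin p) (Fin p) ℝ) (D : E →ₗ[ℝ] E) (e : Fin p → E) : Prop :=
  D.IsSymmetric ∧ ∀ i ≤ 2 * n, ∀ a b, T i a b = inner ℝ ((D ^ i) (e a)) (e b)

theorem IsRepMeasure.exists_isOperatorMoments {n p : ℕ} {S : ℕ → Matrix (Fin p) (Fin p) ℝ} {ℓ : ℕ}
    {x : Fin ℓ → ℝ} {A : Fin ℓ → Matrix (Fin p) (Fin p) ℝ} (h : IsRepMeasure n p S ℓ x A) :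
    ∃ (D : EuclideanSpace ℝ (Fin ℓ × Fin p) →ₗ[ℝ] EuclideanSpace ℝ (Fin ℓ × Fin p))
      (e : Fin p → EuclideanSpace ℝ (Fin ℓ × Fin p)),
      IsOperatorMoments n p S D e ∧ ∀ t, (∀ j, x j ≠ t) → ∀ u, D u = t • u → u = 0 := by
  have hfac : ∀ j, ∃ R : Matrix (Fin p) (Fin p) ℝ, A j = star R * R := fun j ↦ by
    open scoped MatrixOrder in
    exact CStarAlgebra.nonneg_iff_eq_star_mul_self.mp (h.2.1 j).nonneg
  choose R hR using hfac
  let D : EuclideanSpace ℝ (Fin ℓ × Fin p) →ₗ[ℝ] EuclideanSpace ℝ (Fin ℓ × Fin p) :=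
    { toFun := fun u ↦ WithLp.toLp 2 fun jc ↦ x jc.1 * u jc
      map_add' := fun u v ↦ by ext jc; simp [mul_add]
      map_smul' := fun c u ↦ by ext jc; simp; ring }
  have hD : ∀ u jc, D u jc = x jc.1 * u jc := fun u jc ↦ rfl
  let e : Fin p → EuclideanSpace ℝ (Fin ℓ × Fin p) :=
    fun a ↦ WithLp.toLp 2 fun jc ↦ R jc.1 jc.2 a
  have hpow : ∀ i u jc, (D ^ i) u jc = x jc.1 ^ i * u jc := by
    intro i u jc
    induction i with
    | zero => simp
    | succ i ih => rw [pow_succ', Module.End.mul_apply, hD, ih, pow_succ', mul_assoc]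
  refine ⟨D, e, ⟨fun u v ↦ ?_, fun i hi a b ↦ ?_⟩, fun t ht u hu ↦ ?_⟩
  · simp only [PiLp.inner_apply, hD, RCLike.inner_apply, conj_trivial]
    exact Finset.sum_congr rfl fun jc _ ↦ by ring
  · rw [h.2.2.2 i hi, Matrix.sum_apply]
    simp only [PiLp.inner_apply, hpow, RCLike.inner_apply, conj_trivial, Fintype.sum_prod_type]
    refine Finset.sum_congr rfl fun j _ ↦ ?_
    rw [hR j, Matrix.smul_apply, Matrix.mul_apply, smul_eq_mul, Finset.mul_sum]
    refine Finset.sum_congr rfl fun c _ ↦ ?_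
    simp only [e, Matrix.star_apply, star_trivial]
    ring
  · ext jc
    have hjc : D u jc = (t • u) jc := by rw [hu]
    rw [hD, PiLp.smul_apply, smul_eq_mul] at hjc
    exact (mul_eq_zero.mp (by linear_combination hjc : (x jc.1 - t) * u jc = 0)).resolve_left
      (sub_ne_zero.mpr (ht jc.1))

namespace IsOperatorMoments

variable {E : Type*} [NormedAddCommGroup E] [InnerProductSpace ℝ E] {n p : ℕ}
  {T : ℕ → Matrix (Fin p) (Fin p) ℝ} {D : E →ₗ[ℝ] E} {e : Fin p → E}

theorem apply_add (h : IsOperatorMoments n p T D e) {i k : ℕ} (hik : i + k ≤ 2 * n) (a b : Fin p) :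
    T (i + k) a b = inner ℝ ((D ^ i) (e a)) ((D ^ k) (e b)) := by
  rw [h.2 _ hik, add_comm, pow_add, Module.End.mul_apply, h.1.pow k]

theorem shiftT (h : IsOperatorMoments n p T D e) (t : ℝ) :
    IsOperatorMoments n p (shiftT p t T) (D - t • 1) e := by
  refine ⟨fun u v ↦ ?_, fun i hi a b ↦ ?_⟩
  · simp only [LinearMap.sub_apply, LinearMap.smul_apply, Module.End.one_apply, inner_sub_left,
      inner_sub_right, inner_smul_left, inner_smul_right, h.1 u v, conj_trivial]
  · have hcomm : Commute ((-t) • (1 : Module.End ℝ E)) D := (Commute.one_left _).smul_left _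
    have hsplit : D - t • 1 = (-t) • 1 + D := by rw [neg_smul]; abel
    rw [hsplit, hcomm.add_pow, LinearMap.sum_apply, sum_inner, _root_.shiftT, Matrix.sum_apply]
    refine Finset.sum_congr rfl fun l _ ↦ ?_
    rw [Matrix.smul_apply, h.2 _ (by omega), smul_pow, one_pow, smul_mul_assoc, one_mul,
      smul_mul_assoc, ← nsmul_eq_mul', LinearMap.smul_apply, LinearMap.smul_apply,
      ← Nat.cast_smul_eq_nsmul ℝ, inner_smul_left, inner_smul_left, neg_pow, smul_eq_mul]
    simp only [conj_trivial]
    ring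

theorem rank_momentMatrix (h : IsOperatorMoments n p T D e) :
    (momentMatrix n p T).rank = Module.finrank ℝ (krylov D e (n + 1)) := by
  rw [krylov_eq_span_range]
  refine rank_eq_finrank_span_of_gram fun ia kb ↦ h.apply_add ?_ _ _
  have := ia.1.2
  have := kb.1.2
  omega

theorem matN2_mulVec_eq_zero_iff (h : IsOperatorMoments n p T D e) (v : Fin n × Fin p → ℝ) :
    matN2 n p T *ᵥ v = 0 ↔ ∑ ia, v ia • (D ^ ia.1.1) (e ia.2) = 0 := by
  refine mulVec_eq_zero_iff_of_gram (M := matN2 n p T) (g := fun ia ↦ (D ^ ia.1.1) (e ia.2))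
    (fun ia kb ↦ h.apply_add ?_ _ _) v
  have := ia.1.2
  have := kb.1.2
  omega

theorem matN3_mulVec_eq_zero_iff (h : IsOperatorMoments n p T D e) (v : Fin n × Fin p → ℝ) :
    matN3 n p T *ᵥ v = 0 ↔ D (∑ ia, v ia • (D ^ ia.1.1) (e ia.2)) = 0 := by
  have hg : ∀ ia kb : Fin n × Fin p, matN3 n p T ia kb =
      inner ℝ ((D ^ (ia.1.1 + 1)) (e ia.2)) ((D ^ (kb.1.1 + 1)) (e kb.2)) := fun ia kb ↦ by
    have := ia.1.2
    have := kb.1.2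
    rw [← h.apply_add (by omega), matN3]
    congr 1
    omega
  rw [mulVec_eq_zero_iff_of_gram hg, map_sum]
  simp only [map_smul, pow_succ', Module.End.mul_apply]

theorem ker_matN2_eq_ker_matN3_iff (h : IsOperatorMoments n p T D e) :
    (∀ v, matN2 n p T *ᵥ v = 0 ↔ matN3 n p T *ᵥ v = 0) ↔ ∀ u ∈ krylov D e n, D u = 0 → u = 0 := by
  simp only [h.matN2_mulVec_eq_zero_iff, h.matN3_mulVec_eq_zero_iff]
  constructor
  · intro hv u hu hDu
    obtain ⟨v, rfl⟩ := (mem_krylov_iff D e).mp hu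
    exact (hv v).mpr hDu
  · intro hinj v
    exact ⟨fun hv ↦ by rw [hv, map_zero], hinj _ ((mem_krylov_iff D e).mpr ⟨v, rfl⟩)⟩

end IsOperatorMoments

/-- The vectors `D ^ i (e a)` listed in lexicographic order of `(i, a)`, starting from index `1`. -/
def krylovSeq {E : Type*} [AddCommGroup E] [Module ℝ E] {p : ℕ} (hp : 0 < p) (D : E →ₗ[ℝ] E)
    (e : Fin p → E) (m : ℕ) : E :=
  (D ^ ((m - 1) / p)) (e ⟨(m - 1) % p, Nat.mod_lt _ hp⟩)

section krylovSeq

variable {E : Type*} [AddCommGroup E] [Module ℝ E] {p : ℕ} (hp : 0 < p) (D : E →ₗ[ℝ] E)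
  (e : Fin p → E)

theorem krylovSeq_add {m : ℕ} (hm : 1 ≤ m) :
    krylovSeq hp D e (m + p) = D (krylovSeq hp D e m) := by
  have hsub : m + p - 1 = m - 1 + p := by omega
  simp only [krylovSeq, hsub, Nat.add_div_right _ hp, Nat.add_mod_right, pow_succ',
    Module.End.mul_apply]

theorem span_krylovSeq (k : ℕ) :
    Submodule.span ℝ (krylovSeq hp D e '' Set.Icc 1 (k * p)) = krylov D e k := by
  refine congrArg _ (Set.ext fun u ↦ ⟨?_, ?_⟩)
  · rintro ⟨m, ⟨hm1, hm2⟩, rfl⟩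
    exact ⟨_, (Nat.div_lt_iff_lt_mul hp).mpr (by omega), _, rfl⟩
  · rintro ⟨i, hi, a, rfl⟩
    have hle : (i + 1) * p ≤ k * p := Nat.mul_le_mul_right p hi
    refine ⟨i * p + a + 1, ⟨by omega, ?_⟩, ?_⟩
    · have := a.2
      rw [add_mul, one_mul] at hle
      omega
    · have hdiv : (i * p + a) / p = i := by
        rw [Nat.mul_comm, Nat.mul_add_div hp, Nat.div_eq_of_lt a.2, add_zero]
      have hmod : (i * p + a) % p = a := by
        rw [Nat.mul_comm, Nat.mul_add_mod, Nat.mod_eq_of_lt a.2]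
      simp only [krylovSeq, Nat.add_sub_cancel, hdiv, hmod]

theorem image_krylovSeq_Icc_add (m : ℕ) :
    krylovSeq hp D e '' Set.Icc (p + 1) (m + p) = D '' (krylovSeq hp D e '' Set.Icc 1 m) := by
  ext u
  constructor
  · rintro ⟨j, ⟨hj1, hj2⟩, rfl⟩
    refine ⟨_, ⟨j - p, ⟨by omega, by omega⟩, rfl⟩, ?_⟩
    rw [← krylovSeq_add hp D e (by omega), Nat.sub_add_cancel (by omega)]
  · rintro ⟨_, ⟨j, ⟨hj1, hj2⟩, rfl⟩, rfl⟩
    exact ⟨j + p, ⟨by omega, by omega⟩, krylovSeq_add hp D e hj1⟩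

end krylovSeq

/-- Injectivity of a linear map on the span of a finite sequence, tested one vector at a time. -/
theorem forall_mem_map_span_imp_iff {E F : Type*} [AddCommGroup E] [Module ℝ E] [AddCommGroup F]
    [Module ℝ F] (D : E →ₗ[ℝ] F) (g : ℕ → E) (N : ℕ) :
    (∀ m < N, D (g (m + 1)) ∈ (Submodule.span ℝ (g '' Set.Icc 1 m)).map D →
        g (m + 1) ∈ Submodule.span ℝ (g '' Set.Icc 1 m)) ↔
      ∀ u ∈ Submodule.span ℝ (g '' Set.Icc 1 N), D u = 0 → u = 0 := by
  constructor
  · intro h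
    induction N with
    | zero => simp
    | succ N ih =>
      intro u hu hDu
      have ih' := ih fun m hm ↦ h m (by omega)
      rw [← Set.insert_Icc_right_eq_Icc_add_one (by omega), Set.image_insert_eq,
        Submodule.mem_span_insert] at hu
      obtain ⟨c, z, hz, rfl⟩ := hu
      by_cases hc : c = 0
      · subst hc
        rw [zero_smul, zero_add] at hDu ⊢
        exact ih' z hz hDu
      · refine ih' _ (Submodule.add_mem _ (Submodule.smul_mem _ _ (h N (by omega) ?_)) hz) hDu
        refine ⟨-(c⁻¹ • z), Submodule.neg_mem _ (Submodule.smul_mem _ _ hz), ?_⟩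
        rw [map_add, map_smul] at hDu
        rw [map_neg, map_smul, ← smul_neg, ← eq_neg_of_add_eq_zero_left hDu, smul_smul,
          inv_mul_cancel₀ hc, one_smul]
  · rintro h m hm ⟨z, hz, hDz⟩
    have hmono : ∀ k ≤ N, Submodule.span ℝ (g '' Set.Icc 1 k) ≤
        Submodule.span ℝ (g '' Set.Icc 1 N) := fun k hk ↦
      Submodule.span_mono (Set.image_mono (Set.Icc_subset_Icc_right hk))
    have hmem : g (m + 1) - z ∈ Submodule.span ℝ (g '' Set.Icc 1 N) :=
      Submodule.sub_mem _ (Submodule.subset_span ⟨m + 1, ⟨by omega, by omega⟩, rfl⟩)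
        (hmono m (by omega) hz)
    have h0 := h _ hmem (by rw [map_sub, hDz, sub_self])
    rwa [sub_eq_zero.mp h0]

theorem IsOperatorMoments.setA_eq_empty_iff {E : Type*} [NormedAddCommGroup E]
    [InnerProductSpace ℝ E] {n p : ℕ} (hp : 0 < p) {T : ℕ → Matrix (Fin p) (Fin p) ℝ}
    {D : E →ₗ[ℝ] E} {e : Fin p → E} (h : IsOperatorMoments n p T D e) :
    setA n p hp T = ∅ ↔ ∀ u ∈ krylov D e n, D u = 0 → u = 0 := by
  set g := krylovSeq hp D e with hg
  let Φ : E →ₗ[ℝ] (Fin (n + 1) × Fin p → ℝ) :=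
    LinearMap.pi fun ia ↦ innerₛₗ ℝ ((D ^ ia.1.1) (e ia.2))
  have hcol : ∀ j ∈ Set.Icc 1 ((n + 1) * p), colM1 n p hp T j = Φ (g j) := by
    rintro j ⟨hj1, hj2⟩
    have hlt : (j - 1) / p < n + 1 := (Nat.div_lt_iff_lt_mul hp).mpr (by omega)
    ext ia
    have := ia.1.2
    exact h.apply_add (by omega) _ _
  have hΦ : ∀ u ∈ krylov D e (n + 1), Φ u = 0 → u = 0 := by
    intro u hu h0
    have hker : krylov D e (n + 1) ≤ (innerₛₗ ℝ u).ker := by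
      rw [krylov_eq_span_range]
      refine Submodule.span_le.mpr ?_
      rintro _ ⟨ia, rfl⟩
      have := congrFun h0 ia
      simpa [Φ, real_inner_comm] using this
    exact inner_self_eq_zero.mp (hker hu)
  have hmap : ∀ (s : Set ℕ) (j : ℕ), s ⊆ Set.Icc 1 ((n + 1) * p) → j ∈ Set.Icc 1 ((n + 1) * p) →
      (colM1 n p hp T j ∈ Submodule.span ℝ (colM1 n p hp T '' s) ↔
        g j ∈ Submodule.span ℝ (g '' s)) := by
    intro s j hs hj
    have himg : colM1 n p hp T '' s = Φ '' (g '' s) := by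
      rw [Set.image_image]
      exact Set.image_congr fun i hi ↦ hcol i (hs hi)
    rw [himg, hcol j hj, ← Submodule.map_span]
    refine ⟨?_, fun hmem ↦ Submodule.mem_map_of_mem hmem⟩
    rintro ⟨z, hz, hΦz⟩
    have hle : Submodule.span ℝ (g '' s) ≤ krylov D e (n + 1) := by
      rw [← span_krylovSeq hp]
      exact Submodule.span_mono (Set.image_mono hs)
    have hgj : g j ∈ krylov D e (n + 1) := by
      rw [← span_krylovSeq hp]
      exact Submodule.subset_span ⟨j, hj, rfl⟩
    have h0 := hΦ _ (Submodule.sub_mem _ hgj (hle hz)) (by rw [map_sub, hΦz, sub_self])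
    rwa [sub_eq_zero.mp h0]
  rw [← span_krylovSeq hp, ← forall_mem_map_span_imp_iff]
  have hstep : ∀ m < n * p,
      (colM1 n p hp T (m + 1 + p) ∈
          Submodule.span ℝ (colM1 n p hp T '' Set.Icc (p + 1) (m + p)) ↔
        D (g (m + 1)) ∈ (Submodule.span ℝ (g '' Set.Icc 1 m)).map D) ∧
      (colM1 n p hp T (m + 1) ∈ Submodule.span ℝ (colM1 n p hp T '' Set.Icc 1 m) ↔
        g (m + 1) ∈ Submodule.span ℝ (g '' Set.Icc 1 m)) := by
    intro m hm
    have hnp : (n + 1) * p = n * p + p := by ring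
    constructor
    · rw [hmap _ _ (Set.Icc_subset_Icc (by omega) (by omega)) ⟨by omega, by omega⟩, hg,
        krylovSeq_add hp D e (by omega), image_krylovSeq_Icc_add, ← Submodule.map_span]
    · exact hmap _ _ (Set.Icc_subset_Icc_right (by omega)) ⟨by omega, by omega⟩
  rw [Set.eq_empty_iff_forall_notMem]
  constructor
  · intro hA m hm
    rw [← (hstep m hm).1, ← (hstep m hm).2]
    intro h1
    by_contra h2
    have hdiv : m / p < n := (Nat.div_lt_iff_lt_mul hp).mpr hm
    have hmod := Nat.mod_lt m hp
    have hdm : m / p * p + m % p = m := Nat.div_add_mod' m p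
    have hk : (m / p + 1) * p + (m % p + 1) = m + 1 + p := by rw [add_mul]; omega
    refine hA (m % p + 1) ⟨⟨by omega, by omega⟩, m / p + 1, ⟨Nat.le_add_left 1 _, hdiv⟩, ?_, ?_⟩
    · rw [hk, show m + 1 + p - 1 = m + p by omega]
      exact h1
    · rwa [Nat.add_sub_cancel, ← add_assoc, hdm, Nat.add_sub_cancel]
  · rintro hA i ⟨⟨hi1, hi2⟩, k, ⟨hk1, hk2⟩, h1, h2⟩
    obtain ⟨k, rfl⟩ := Nat.exists_eq_add_of_le' hk1
    obtain ⟨i, rfl⟩ := Nat.exists_eq_add_of_le' hi1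
    have hm : k * p + i < n * p := by
      have := Nat.mul_le_mul_right p hk2
      rw [add_mul] at this
      omega
    have hk : (k + 1) * p + (i + 1) = k * p + i + 1 + p := by ring
    rw [hk, show k * p + i + 1 + p - 1 = k * p + i + p by omega, (hstep _ hm).1] at h1
    rw [Nat.add_sub_cancel, ← add_assoc, Nat.add_sub_cancel, (hstep _ hm).2] at h2
    exact h2 (hA _ hm h1)

theorem exists_minimal_isRepMeasure {n p : ℕ} {S : ℕ → Matrix (Fin p) (Fin p) ℝ} {E : Type*}
    [NormedAddCommGroup E] [InnerProductSpace ℝ E] [FiniteDimensional ℝ E] {D : E →ₗ[ℝ] E}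
    {e : Fin p → E} (h : IsOperatorMoments n p S D e) (t : ℝ)
    (hinj : ∀ u ∈ krylov (D - t • 1) e n, (D - t • 1) u = 0 → u = 0) :
    ∃ (ℓ : ℕ) (x : Fin ℓ → ℝ) (A : Fin ℓ → Matrix (Fin p) (Fin p) ℝ),
      IsRepMeasure n p S ℓ x A ∧ IsMinimal n p S A ∧ MultEq x A t 0 := by
  obtain ⟨y, w, hy, hmom⟩ := exists_quadrature D h.1 e n t fun u hu hDu ↦
    hinj u (krylov_le_krylov_sub D e t n hu) (by simp [hDu])
  obtain ⟨ℓ, x, A, hA, hrank, hx⟩ := exists_isRepMeasure_of_weighted_points y w hy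
    fun i hi a b ↦ (h.2 i hi a b).trans (hmom i hi a b)
  exact ⟨ℓ, x, A, hA, le_antisymm (hrank.trans h.rank_momentMatrix.ge) hA.rank_momentMatrix_le,
    Or.inr ⟨hx, rfl⟩⟩

/-- **Theorem 1.3**: existence of a minimal representing measure avoiding the atom `t`
is equivalent to `A = ∅`, and also equivalent to `Ker N₂ = Ker N₃`. -/
theorem atom_avoidance (n p : ℕ) (hn : 1 ≤ n) (hp : 0 < p)
    (S : ℕ → Matrix (Fin p) (Fin p) ℝ) (hsymm : ∀ i, i ≤ 2 * n → (S i).IsSymm)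
    (hrep : ∃ ℓ x A, IsRepMeasure n p S ℓ x A) (t : ℝ) :
    ((∃ (ℓ : ℕ) (x : Fin ℓ → ℝ) (A : Fin ℓ → Matrix (Fin p) (Fin p) ℝ),
        IsRepMeasure n p S ℓ x A ∧ IsMinimal n p S A ∧ MultEq x A t 0) ↔
      setA n p hp (shiftT p t S) = ∅) ∧
    ((∃ (ℓ : ℕ) (x : Fin ℓ → ℝ) (A : Fin ℓ → Matrix (Fin p) (Fin p) ℝ),
        IsRepMeasure n p S ℓ x A ∧ IsMinimal n p S A ∧ MultEq x A t 0) ↔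
      ∀ v : Fin n × Fin p → ℝ,
        (matN2 n p (shiftT p t S)).mulVec v = 0 ↔
          (matN3 n p (shiftT p t S)).mulVec v = 0) := by
  obtain ⟨ℓ, x, A, hA⟩ := hrep
  obtain ⟨D, e, hD, -⟩ := hA.exists_isOperatorMoments
  have hker := (hD.shiftT t).ker_matN2_eq_ker_matN3_iff
  have hset := (hD.shiftT t).setA_eq_empty_iff hp
  have hmain : (∃ (ℓ : ℕ) (x : Fin ℓ → ℝ) (A : Fin ℓ → Matrix (Fin p) (Fin p) ℝ),
        IsRepMeasure n p S ℓ x A ∧ IsMinimal n p S A ∧ MultEq x A t 0) ↔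
      ∀ u ∈ krylov (D - t • 1) e n, (D - t • 1) u = 0 → u = 0 := by
    refine ⟨?_, exists_minimal_isRepMeasure hD t⟩
    rintro ⟨ℓ', x', A', hA', -, hmult⟩
    have hx' : ∀ j, x' j ≠ t := by
      rcases hmult with ⟨j, -, hj⟩ | ⟨hx', -⟩
      · exact absurd (Matrix.eq_zero_of_rank_eq_zero hj) (hA'.2.2.1 j)
      · exact hx'
    obtain ⟨D', e', hD', hinj⟩ := hA'.exists_isOperatorMoments
    rw [← hker, (hD'.shiftT t).ker_matN2_eq_ker_matN3_iff]
    intro u _ hu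
    exact hinj t hx' u (sub_eq_zero.mp (by simpa using hu))
  exact ⟨hmain.trans hset.symm, hmain.trans hker.symm⟩
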